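/- arXiv:2209.04615 — 2 statements merged into one kernel-verified Lean document; each statement's English description precedes it below -/
import Mathlib

section
/- Consider the lattice x(s) = 4βs² + 𝔠₅s + 𝔠₆ with β, 𝔠₅, 𝔠₆ ∈ ℂ, (β,𝔠₅) ≠ (0,0), and the operators D_x, S_x as in the context. Suppose (P_n) is a monic OPS with respect to some regular linear functional u, with recurrence coefficients B_n, C_n, satisfying D_xP_{n+1} = (n+1)·S_xP_n for every n ≥ 0. Then necessarily β = 0 (so the lattice is linear and 𝔠₅ ≠ 0), and in that case B_n = B₀ for all n ≥ 0 and C_{n+1} = (n+1)·(C₁ − n𝔠₅²/4) for all n ≥ 0. (Up to an affine change of variable these are the Meixner polynomials of the second kind M_n(·;0,−4C₁/𝔠₅²), which requires 4C₁/𝔠₅² ∉ {0,−1,−2,…} for regularity.) -/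
open Polynomial

noncomputable def latQ (β c5 c6 s : ℂ) : ℂ := 4 * β * s ^ 2 + c5 * s + c6

theorem latQ_surjective {β c5 : ℂ} (c6 : ℂ) (h : ¬(β = 0 ∧ c5 = 0)) :
    Function.Surjective (latQ β c5 c6) := by
  intro x
  unfold latQ
  by_cases hβ : β = 0
  · have h5 : c5 ≠ 0 := fun h5 => h ⟨hβ, h5⟩
    refine ⟨(x - c6) / c5, ?_⟩
    subst hβ
    field_simp
    ring
  · obtain ⟨r, hr⟩ := IsAlgClosed.exists_pow_nat_eq (c5 ^ 2 + 16 * β * (x - c6)) two_pos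
    refine ⟨(r - c5) / (8 * β), ?_⟩
    field_simp
    linear_combination 4 * hr

/-- Two polynomials agreeing wherever a nonzero polynomial does not vanish are equal. -/
theorem eq_of_eval_eq_of_eval_ne_zero {U p q : Polynomial ℂ} (hU : U ≠ 0)
    (h : ∀ x, U.eval x ≠ 0 → p.eval x = q.eval x) : p = q := by
  refine mul_left_cancel₀ hU (Polynomial.funext fun x => ?_)
  by_cases hx : U.eval x = 0
  · simp [hx]
  · simp [h x hx]

theorem monic_natDegree_of_three_term {Q : ℕ → Polynomial ℂ} {b c : ℕ → ℂ} {b₀ : ℂ}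
    (h0 : Q 0 = 1) (h1 : Q 1 = X - C b₀)
    (h : ∀ n, Q (n + 2) = (X - C (b n)) * Q (n + 1) - C (c n) * Q n) (n : ℕ) :
    (Q n).Monic ∧ (Q n).natDegree = n := by
  suffices H : ((Q n).Monic ∧ (Q n).natDegree = n) ∧
      ((Q (n + 1)).Monic ∧ (Q (n + 1)).natDegree = n + 1) from H.1
  induction n with
  | zero => simp [h0, h1, monic_X_sub_C]
  | succ n ih =>
    obtain ⟨⟨_, hd⟩, hm', hd'⟩ := ih
    refine ⟨⟨hm', hd'⟩, ?_⟩
    have hm2 : ((X - C (b n)) * Q (n + 1)).Monic := (monic_X_sub_C _).mul hm'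
    have hd2 : ((X - C (b n)) * Q (n + 1)).natDegree = n + 2 := by
      rw [(monic_X_sub_C _).natDegree_mul hm', natDegree_X_sub_C, hd']
      ring
    have hlt : (C (c n) * Q n).natDegree < ((X - C (b n)) * Q (n + 1)).natDegree := by
      have := natDegree_C_mul_le (c n) (Q n)
      omega
    rw [h n]
    refine ⟨hm2.sub_of_left (degree_lt_degree hlt), ?_⟩
    rw [natDegree_sub_eq_left_of_natDegree_lt hlt, hd2]

theorem stmt_18 (β c5 c6 : ℂ) (hbc : ¬(β = 0 ∧ c5 = 0))
    (Dx Sx : Polynomial ℂ → Polynomial ℂ)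
    (hDx : ∀ (f : Polynomial ℂ) (s : ℂ),
      latQ β c5 c6 (s + 1/2) ≠ latQ β c5 c6 (s - 1/2) →
      (Dx f).eval (latQ β c5 c6 s) =
        (f.eval (latQ β c5 c6 (s + 1/2)) - f.eval (latQ β c5 c6 (s - 1/2))) /
          (latQ β c5 c6 (s + 1/2) - latQ β c5 c6 (s - 1/2)))
    (hSx : ∀ (f : Polynomial ℂ) (s : ℂ),
      (Sx f).eval (latQ β c5 c6 s) =
        (f.eval (latQ β c5 c6 (s + 1/2)) + f.eval (latQ β c5 c6 (s - 1/2))) / 2)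
    (u : Polynomial ℂ →ₗ[ℂ] ℂ)
    (P : ℕ → Polynomial ℂ)
    (hPm : ∀ n, (P n).Monic) (hPd : ∀ n, (P n).natDegree = n)
    (hPo : ∀ n m, n ≠ m → u (P n * P m) = 0)
    (hPn : ∀ n, u (P n * P n) ≠ 0)
    (B Cc : ℕ → ℂ)
    (hT1 : P 1 = (X - C (B 0)) * P 0)
    (hT : ∀ n, 1 ≤ n → P (n + 1) = (X - C (B n)) * P n - C (Cc n) * P (n - 1))
    (hCne : ∀ n, 1 ≤ n → Cc n ≠ 0)
    (hk : ∀ n : ℕ, Dx (P (n + 1)) = C ((n : ℂ) + 1) * Sx (P n)) :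
    β = 0 ∧ c5 ≠ 0 ∧ (∀ n : ℕ, B n = B 0) ∧
    (∀ n : ℕ, Cc (n + 1) = ((n : ℂ) + 1) * (Cc 1 - (n : ℂ) * c5 ^ 2 / 4)) := by
  have hP0 : P 0 = 1 := (hPm 0).natDegree_eq_zero.mp (hPd 0)
  obtain ⟨Q, hQ⟩ : ∃ Q : ℕ → Polynomial ℂ, ∀ n, Q n = Sx (P n) := ⟨_, fun _ => rfl⟩
  -- The shifted points are `x + β ± δ` with `δ ^ 2` affine in `x`.
  have shift : ∀ x, ∃ δ : ℂ, δ ^ 2 = 4 * β * (x - c6) + c5 ^ 2 / 4 ∧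
      (∀ n, (P n).eval (x + β + δ) + (P n).eval (x + β - δ) = 2 * (Q n).eval x) ∧
      (∀ n : ℕ, (P (n + 1)).eval (x + β + δ) - (P (n + 1)).eval (x + β - δ) =
        2 * δ * ((n + 1) * (Q n).eval x)) := by
    intro x
    obtain ⟨s, rfl⟩ := latQ_surjective c6 hbc x
    have hp : latQ β c5 c6 (s + 1 / 2) = latQ β c5 c6 s + β + (4 * β * s + c5 / 2) := by
      unfold latQ; ring
    have hm : latQ β c5 c6 (s - 1 / 2) = latQ β c5 c6 s + β - (4 * β * s + c5 / 2) := by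
      unfold latQ; ring
    refine ⟨4 * β * s + c5 / 2, by unfold latQ; ring, fun n => ?_, fun n => ?_⟩
    · rw [hQ, hSx, hp, hm]; ring
    · by_cases hne : latQ β c5 c6 (s + 1 / 2) = latQ β c5 c6 (s - 1 / 2)
      · rw [← hp, ← hm, hne]
        have : 2 * (4 * β * s + c5 / 2) = 0 := by linear_combination hne - hp + hm
        rw [this]; ring
      · have h1 := hDx (P (n + 1)) s hne
        rw [hk, eval_mul, eval_C, ← hQ, eq_div_iff (sub_ne_zero.mpr hne), hp, hm] at h1
        rw [← h1]; ring
  have step : ∀ n y, (P (n + 2)).eval y =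
      (y - B (n + 1)) * (P (n + 1)).eval y - Cc (n + 1) * (P n).eval y := by
    intro n y
    rw [hT (n + 1) (by omega)]
    simp
  have hQ0 : Q 0 = 1 := Polynomial.funext fun x => by
    obtain ⟨δ, -, hs, -⟩ := shift x
    have := hs 0
    simp only [hP0, eval_one] at this ⊢
    linear_combination -this / 2
  have hQ1 : Q 1 = X - C (B 0 - β) := Polynomial.funext fun x => by
    obtain ⟨δ, -, hs, -⟩ := shift x
    have := hs 1
    simp only [hT1, hP0, mul_one, eval_sub, eval_X, eval_C] at this ⊢
    linear_combination -this / 2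
  have sum_rec : ∀ (n : ℕ) x, (Q (n + 2)).eval x = (x + β - B (n + 1)) * (Q (n + 1)).eval x +
      ((n + 1) * (4 * β * (x - c6) + c5 ^ 2 / 4) - Cc (n + 1)) * (Q n).eval x := by
    intro n x
    obtain ⟨δ, hδ, hs, hd⟩ := shift x
    have h2 := hs (n + 2)
    rw [step, step] at h2
    rw [← hδ]
    linear_combination -h2 / 2 + (x + β - B (n + 1)) / 2 * hs (n + 1) + δ / 2 * hd n
      - Cc (n + 1) / 2 * hs n
  have hU : C (4 * β) * (X - C c6) + C (c5 ^ 2 / 4) ≠ 0 := by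
    intro h0
    have e0 := congrArg (eval c6) h0
    have e1 := congrArg (eval (c6 + 1)) h0
    simp at e0 e1
    exact hbc ⟨by simpa [e0] using e1, e0⟩
  have diff_rec : ∀ n : ℕ, Q (n + 2) = (X - C (B (n + 2) - β)) * Q (n + 1) -
      C (Cc (n + 2) * (n + 1) / (n + 2)) * Q n := by
    intro n
    refine eq_of_eval_eq_of_eval_ne_zero hU fun x hx => ?_
    obtain ⟨δ, hδ, hs, hd⟩ := shift x
    have hδ0 : δ ≠ 0 := by
      rintro rfl
      apply hx
      simp only [eval_add, eval_mul, eval_sub, eval_X, eval_C]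
      rw [← hδ]; ring
    have h3 := hd (n + 2)
    rw [step (n + 1), step (n + 1)] at h3
    have h2 := hd (n + 1)
    have hn : (n : ℂ) + 2 ≠ 0 := by exact_mod_cast (by omega : n + 2 ≠ 0)
    push_cast at h2 h3
    have e : (n + 2) * (Q (n + 2)).eval x = (n + 2) * (x + β - B (n + 2)) * (Q (n + 1)).eval x -
        Cc (n + 2) * (n + 1) * (Q n).eval x := by
      refine mul_left_cancel₀ (mul_ne_zero two_ne_zero hδ0) ?_
      linear_combination -h3 + (x + β - B (n + 2)) * h2 + δ * hs (n + 2) - Cc (n + 2) * hd n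
    simp only [eval_mul, eval_sub, eval_X, eval_C]
    field_simp
    linear_combination e
  have diff_rec_eval : ∀ (n : ℕ) x, (n + 2) * (Q (n + 2)).eval x =
      (n + 2) * (x + β - B (n + 2)) * (Q (n + 1)).eval x -
        Cc (n + 2) * (n + 1) * (Q n).eval x := by
    intro n x
    have hn : (n : ℂ) + 2 ≠ 0 := by exact_mod_cast (by omega : n + 2 ≠ 0)
    rw [diff_rec]
    simp only [eval_mul, eval_sub, eval_X, eval_C]
    field_simp
    ring
  have key : ∀ (n : ℕ) x, (n + 2) * (B (n + 1) - B (n + 2)) * (Q (n + 1)).eval x =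
      ((n + 2) * ((n + 1) * (4 * β * (x - c6) + c5 ^ 2 / 4) - Cc (n + 1)) +
        Cc (n + 2) * (n + 1)) * (Q n).eval x := by
    intro n x
    linear_combination (n + 2) * sum_rec n x - diff_rec_eval n x
  have hβ : β = 0 := by
    have hQ1e : ∀ x, (Q 1).eval x = x - (B 0 - β) := fun x => by simp [hQ1]
    have hB : B 2 - B 3 = 0 := by
      have e2 := diff_rec_eval 0 (B 0 - β)
      have e3 := key 1 (B 0 - β)
      norm_num [hQ1e, hQ0] at e2 e3
      rcases e3 with e3 | e3
      · exact e3
      · rw [e3] at e2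
        exact absurd (by linear_combination e2) (hCne 2 (by omega))
    have f1 := key 1 (B 0 - β + 1)
    have f2 := key 1 (B 0 - β + 2)
    norm_num [hQ1e, hB] at f1 f2
    linear_combination (f1 + f2) / 24
  subst hβ
  have hQd := monic_natDegree_of_three_term (c := fun n => Cc (n + 2) * (n + 1) / (n + 2))
    hQ0 hQ1 diff_rec
  have hB : ∀ n, B (n + 1) = B (n + 2) := by
    intro n
    by_contra hne
    have hn : (n : ℂ) + 2 ≠ 0 := by exact_mod_cast (by omega : n + 2 ≠ 0)
    have hpoly : C ((n + 2) * (B (n + 1) - B (n + 2))) * Q (n + 1) =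
        C ((n + 2) * ((n + 1) * (c5 ^ 2 / 4) - Cc (n + 1)) + Cc (n + 2) * (n + 1)) * Q n :=
      Polynomial.funext fun x => by
        simp only [eval_mul, eval_C]
        linear_combination key n x
    have hd := congrArg natDegree hpoly
    rw [natDegree_C_mul (mul_ne_zero hn (sub_ne_zero.mpr hne)), (hQd (n + 1)).2] at hd
    have := hd.le.trans ((natDegree_C_mul_le _ _).trans_eq (hQd n).2)
    omega
  have hB1 : B 1 = B 0 := by
    obtain ⟨δ, hδ, -, hd⟩ := shift 0
    have hδ0 : δ ≠ 0 := by
      rintro rfl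
      exact hbc ⟨rfl, by simpa using hδ.symm⟩
    have h2 := hd 1
    norm_num [step, hT1, hP0, hQ1] at h2
    refine mul_left_cancel₀ hδ0 ?_
    linear_combination -h2 / 2
  refine ⟨rfl, fun h5 => hbc ⟨rfl, h5⟩, fun n => ?_, fun n => ?_⟩
  · cases n with
    | zero => rfl
    | succ n =>
      induction n with
      | zero => exact hB1
      | succ n ih => rw [← hB n, ih]
  · induction n with
    | zero => simp
    | succ n ih =>
      obtain ⟨x, hx⟩ : ∃ x, (Q n).eval x ≠ 0 := by
        by_contra! h
        exact (hQd n).1.ne_zero (Polynomial.funext fun x => by simpa using h x)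
      have hn : (n : ℂ) + 1 ≠ 0 := by exact_mod_cast n.succ_ne_zero
      have hkey := key n x
      rw [hB n, sub_self, mul_zero, zero_mul, eq_comm, mul_eq_zero, or_iff_left hx, ih] at hkey
      refine mul_right_cancel₀ hn ?_
      push_cast
      linear_combination hkey
end

section
/- With the q-quadratic lattice, the operators D_x, S_x, and the notion of regular functional as in the context, let (P_n) be the monic OPS with respect to a regular functional u, with recurrence coefficients B_n, C_n, and suppose there are scalars c_n ∈ ℂ, c_n ≠ 0 for n ≥ 1, such that D_xP_n = c_n·P_{n−1} for every n ≥ 1. Then c_n = γ_n for all n ≥ 1, B_n = 𝔠₃ for all n ≥ 0, and either C_{n+1} = (1 − q^{n+1})𝔠₁𝔠₂ for all n ≥ 0 or C_{n+1} = (1 − q^{−(n+1)})𝔠₁𝔠₂ for all n ≥ 0. (Up to an affine change of variable, (P_n) is thus the sequence of monic continuous q-Hermite polynomials of Rogers.) -/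
open Polynomial

noncomputable def qp (q : ℝ) (t : ℂ) : ℂ := Complex.exp (t * (Real.log q : ℂ))

noncomputable def alphaL (q : ℝ) : ℂ := (qp q (1/2) + qp q (-(1/2))) / 2

noncomputable def alphaN (q : ℝ) (n : ℕ) : ℂ :=
  (qp q ((n : ℂ) / 2) + qp q (-((n : ℂ) / 2))) / 2

noncomputable def gammaN (q : ℝ) (n : ℕ) : ℂ :=
  (qp q ((n : ℂ) / 2) - qp q (-((n : ℂ) / 2))) / (qp q (1/2) - qp q (-(1/2)))

noncomputable def latX (q : ℝ) (c1 c2 c3 s : ℂ) : ℂ := c1 * qp q (-s) + c2 * qp q s + c3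

/-- A vanishing linear combination of consecutive members of a sequence of monic polynomials
with `natDegree (P n) = n` is trivial. -/
lemma coeffs_eq_zero_of_consecutive {P : ℕ → ℂ[X]} (hPm : ∀ n, (P n).Monic)
    (hPd : ∀ n, (P n).natDegree = n) (n : ℕ) (a₀ a₁ a₂ a₃ a₄ : ℂ)
    (h : C a₄ * P (n + 4) + C a₃ * P (n + 3) + C a₂ * P (n + 2) + C a₁ * P (n + 1)
      + C a₀ * P n = 0) : a₄ = 0 ∧ a₃ = 0 ∧ a₂ = 0 ∧ a₁ = 0 ∧ a₀ = 0 := by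
  have top (k : ℕ) : (P k).coeff k = 1 := by
    simpa [Polynomial.Monic, Polynomial.leadingCoeff, hPd k] using hPm k
  have low {j k : ℕ} (hjk : j < k) : (P j).coeff k = 0 :=
    coeff_eq_zero_of_natDegree_lt (by rwa [hPd])
  have h4 : a₄ = 0 := by
    simpa [top, low] using congrArg (fun f => f.coeff (n + 4)) h
  subst h4
  have h3 : a₃ = 0 := by
    simpa [top, low] using congrArg (fun f => f.coeff (n + 3)) h
  subst h3
  have h2 : a₂ = 0 := by
    simpa [top, low] using congrArg (fun f => f.coeff (n + 2)) h
  subst h2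
  have h1 : a₁ = 0 := by
    simpa [top, low] using congrArg (fun f => f.coeff (n + 1)) h
  subst h1
  have h0 : a₀ = 0 := by
    simpa [top, low] using congrArg (fun f => f.coeff n) h
  exact ⟨rfl, rfl, rfl, rfl, h0⟩

/-- Two polynomials that agree off the zeros of `(w - e)² = d` are equal. -/
lemma eq_of_eval_eq_off_quadric {f g : ℂ[X]} (e d : ℂ)
    (h : ∀ w : ℂ, (w - e) ^ 2 ≠ d → f.eval w = g.eval w) : f = g := by
  have hne : ((X - C e) ^ 2 - C d : ℂ[X]) ≠ 0 := by
    intro h0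
    have h2 := congrArg (fun f => f.eval e) h0
    have h3 := congrArg (fun f => f.eval (e + 1)) h0
    simp at h2 h3
    simp [h2] at h3
  have h0 : (f - g) * ((X - C e) ^ 2 - C d) = 0 := by
    apply Polynomial.funext
    intro w
    by_cases hw : (w - e) ^ 2 = d
    · simp [hw]
    · simp [h w hw]
  exact sub_eq_zero.mp ((mul_eq_zero.mp h0).resolve_right hne)

/-- `a` and `b` are the two neighbours of the lattice point `w`, and `D`, `S` act at `w` as the
divided difference and the average over them. -/
structure LatticePair (D S : ℂ[X] → ℂ[X]) (α e d w a b : ℂ) : Prop where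
  ne : a ≠ b
  sum_eq : a + b = 2 * α * (w - e) + 2 * e
  sq_sub : (a - b) ^ 2 = 4 * (α ^ 2 - 1) * ((w - e) ^ 2 - 4 * d)
  diff (f : ℂ[X]) : (D f).eval w * (a - b) = f.eval a - f.eval b
  avg (f : ℂ[X]) : (S f).eval w * 2 = f.eval a + f.eval b

section Operators

variable {D S : ℂ[X] → ℂ[X]} {α e d : ℂ}

lemma divDiff_const
    (H : ∀ w, (w - e) ^ 2 ≠ 4 * d → ∃ a b, LatticePair D S α e d w a b) (k : ℂ) :
    D (C k) = 0 := by
  refine eq_of_eval_eq_off_quadric e (4 * d) fun w hw => ?_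
  obtain ⟨a, b, h⟩ := H w hw
  apply mul_right_cancel₀ (sub_ne_zero.mpr h.ne)
  simp [h.diff]

lemma avg_const
    (H : ∀ w, (w - e) ^ 2 ≠ 4 * d → ∃ a b, LatticePair D S α e d w a b) (k : ℂ) :
    S (C k) = C k := by
  refine eq_of_eval_eq_off_quadric e (4 * d) fun w hw => ?_
  obtain ⟨a, b, h⟩ := H w hw
  apply mul_right_cancel₀ (two_ne_zero (α := ℂ))
  rw [h.avg, eval_C, eval_C, eval_C, mul_two]

lemma divDiff_recurrence
    (H : ∀ w, (w - e) ^ 2 ≠ 4 * d → ∃ a b, LatticePair D S α e d w a b)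
    (f g : ℂ[X]) (β κ : ℂ) :
    D (((X - C e) - C β) * f - C κ * g)
      = S f + (C α * (X - C e) - C β) * D f - C κ * D g := by
  refine eq_of_eval_eq_off_quadric e (4 * d) fun w hw => ?_
  obtain ⟨a, b, h⟩ := H w hw
  apply mul_right_cancel₀ (sub_ne_zero.mpr h.ne)
  rw [h.diff]
  have h1 := h.diff f
  have h2 := h.diff g
  have h3 := h.avg f
  have h4 := h.sum_eq
  simp only [eval_sub, eval_add, eval_mul, eval_X, eval_C]
  linear_combination (-(α * (w - e) - β)) * h1 + κ * h2 - (a - b) / 2 * h3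
    + (eval a f - eval b f) / 2 * h4

lemma avg_recurrence
    (H : ∀ w, (w - e) ^ 2 ≠ 4 * d → ∃ a b, LatticePair D S α e d w a b)
    (f g : ℂ[X]) (β κ : ℂ) :
    S (((X - C e) - C β) * f - C κ * g)
      = (C α * (X - C e) - C β) * S f
        + C (α ^ 2 - 1) * ((X - C e) ^ 2 - C (4 * d)) * D f - C κ * S g := by
  refine eq_of_eval_eq_off_quadric e (4 * d) fun w hw => ?_
  obtain ⟨a, b, h⟩ := H w hw
  apply mul_right_cancel₀ (two_ne_zero (α := ℂ))
  rw [h.avg]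
  have h1 := h.diff f
  have h2 := h.avg g
  have h3 := h.avg f
  have h4 := h.sum_eq
  have h5 := h.sq_sub
  simp only [eval_sub, eval_add, eval_mul, eval_X, eval_C, eval_pow]
  linear_combination (-(α * (w - e) - β)) * h3 + κ * h2 - (a - b) / 2 * h1
    + (eval a f + eval b f) / 2 * h4 + (D f).eval w / 2 * h5

end Operators

/-- Relations between the recurrence coefficients `b`, `K` and the multipliers `c` of a
sequence of monic polynomials, obtained by expanding the averaging operator in the sequence. -/
lemma appell_coefficient_relations {P T : ℕ → ℂ[X]} {Y : ℂ[X]} {α d : ℂ} {b K c : ℕ → ℂ}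
    (hPm : ∀ n, (P n).Monic) (hPd : ∀ n, (P n).natDegree = n)
    (hc0 : c 0 = 0) (hc1 : c 1 = 1) (hK0 : K 0 = 0)
    (hP : ∀ n, P (n + 1) = (Y - C (b n)) * P n - C (K n) * P (n - 1))
    (hT : ∀ n, C (c (n + 1)) * P n = T n + (C α * Y - C (b n)) * (C (c n) * P (n - 1))
      - C (K n) * (C (c (n - 1)) * P (n - 1 - 1)))
    (hT' : ∀ n, T (n + 1) = (C α * Y - C (b n)) * T n
      + C (α ^ 2 - 1) * (Y ^ 2 - C (4 * d)) * (C (c n) * P (n - 1)) - C (K n) * T (n - 1)) :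
    (∀ n, c (n + 2) = 2 * α * c (n + 1) - c n) ∧
    b 1 = (2 * α - 1) * b 0 ∧
    (∀ n, c (n + 2) * (b (n + 2) - α * b (n + 1))
      = (α - 1) * (c (n + 2) - α * c (n + 1)) * b (n + 1)
        + α * c (n + 1) * (b (n + 1) - α * b n)
        + (α ^ 2 - 1) * c (n + 1) * (b (n + 1) + b n)) ∧
    (∀ n, c (n + 1) * K (n + 2) - α * c (n + 2) * K (n + 1)
      = α * (c (n + 2) - α * c (n + 1)) * K (n + 1)
        - c (n + 1) * (b (n + 1) - α * b n) ^ 2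
        + α * (c n * K (n + 1) - α * c (n + 1) * K n)
        + (α ^ 2 - 1) * c (n + 1) * (K (n + 1) + b n ^ 2 + K n - 4 * d)
        - K (n + 1) * (c (n + 1) - α * c n)) ∧
    α * (c 2 * (b 2 - α * b 1)) * K 1 + (c 1 * K 2 - α * c 2 * K 1) * (α * b 0 - b 2)
      + (α ^ 2 - 1) * c 2 * K 1 * (b 1 + b 0) - K 2 * (c 1 * (b 1 - α * b 0)) = 0 ∧
    α * (c 2 * K 3 - α * c 3 * K 2) * K 1 + (α ^ 2 - 1) * c 3 * K 2 * K 1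
      - K 3 * (c 1 * K 2 - α * c 2 * K 1) = 0 := by
  have hY (n : ℕ) : Y * P n = P (n + 1) + C (b n) * P n + C (K n) * P (n - 1) := by
    rw [hP n]; ring
  have E0 : T 0 = P 0 := by
    have := hT 0
    simp [hc0, hc1, hK0] at this
    exact this.symm
  have E1 : T 1 = C (c 2 - α * c 1) * P 1 + C (c 1 * (b 1 - α * b 0)) * P 0 := by
    have h := hT 1
    have h' := hY 0
    simp only [hc0, hK0, map_zero, map_sub, map_mul, Nat.reduceSub, Nat.reduceAdd] at h h' ⊢
    linear_combination -h - C α * C (c 1) * h'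
  have E (n : ℕ) : T (n + 2) = C (c (n + 3) - α * c (n + 2)) * P (n + 2)
      + C (c (n + 2) * (b (n + 2) - α * b (n + 1))) * P (n + 1)
      + C (c (n + 1) * K (n + 2) - α * c (n + 2) * K (n + 1)) * P n := by
    have h := hT (n + 2)
    have h' := hY (n + 1)
    simp only [map_sub, map_mul, Nat.add_succ_sub_one, Nat.add_sub_cancel] at h h' ⊢
    simp only [add_assoc, Nat.reduceAdd] at h h' ⊢
    linear_combination -h - C α * C (c (n + 2)) * h'
  have R0 : C (0 : ℂ) * P 4 + C 0 * P 3 + C 0 * P 2 + C (c 2 - 2 * α * c 1) * P 1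
      + C (c 1 * (b 1 - α * b 0) - (α - 1) * b 0) * P 0 = 0 := by
    have h := hT' 0
    have h0 := hY 0
    simp only [hc0, hc1, hK0, E1, E0, map_zero, map_one, map_sub, map_mul, map_ofNat, zero_add]
      at h h0 ⊢
    linear_combination h + C α * h0
  have R1 : C (0 : ℂ) * P 4 + C 0 * P 3
      + C (c 3 - α * c 2 - α * (c 2 - α * c 1) - (α ^ 2 - 1) * c 1) * P 2
      + C (c 2 * (b 2 - α * b 1) - α * (c 2 - α * c 1) * b 1 - α * (c 1 * (b 1 - α * b 0))
        + b 1 * (c 2 - α * c 1) - (α ^ 2 - 1) * c 1 * (b 1 + b 0)) * P 1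
      + C (c 1 * K 2 - α * c 2 * K 1 - α * (c 2 - α * c 1) * K 1
        - c 1 * (b 1 - α * b 0) * (α * b 0 - b 1)
        - (α ^ 2 - 1) * c 1 * (K 1 + b 0 ^ 2 - 4 * d) + K 1) * P 0 = 0 := by
    have h := hT' 1
    have h0 := hY 0
    have h1 := hY 1
    have e2 := E 0
    simp only [hc1, hK0, E1, E0, map_zero, map_one, map_sub, map_add, map_mul, map_pow,
      map_ofNat, zero_add, Nat.reduceAdd, Nat.reduceSub] at h h0 h1 e2 ⊢
    linear_combination h - e2 + C α * (C (c 2) - C α) * h1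
      + C α * (C (b 1) - C α * C (b 0)) * h0
      + (C α ^ 2 - 1) * (Y * h0 + h1 + C (b 0) * h0)
  have R2 : C (0 : ℂ) * P 4
      + C (c 4 - α * c 3 - α * (c 3 - α * c 2) - (α ^ 2 - 1) * c 2) * P 3
      + C (c 3 * (b 3 - α * b 2) - α * (c 3 - α * c 2) * b 2 - α * (c 2 * (b 2 - α * b 1))
        + b 2 * (c 3 - α * c 2) - (α ^ 2 - 1) * c 2 * (b 2 + b 1)) * P 2
      + C (c 2 * K 3 - α * c 3 * K 2 - α * (c 3 - α * c 2) * K 2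
        - c 2 * (b 2 - α * b 1) * (α * b 1 - b 2) - α * (c 1 * K 2 - α * c 2 * K 1)
        - (α ^ 2 - 1) * c 2 * (K 2 + b 1 ^ 2 + K 1 - 4 * d) + K 2 * (c 2 - α * c 1)) * P 1
      + C (-(α * (c 2 * (b 2 - α * b 1)) * K 1
        + (c 1 * K 2 - α * c 2 * K 1) * (α * b 0 - b 2)
        + (α ^ 2 - 1) * c 2 * K 1 * (b 1 + b 0) - K 2 * (c 1 * (b 1 - α * b 0)))) * P 0 = 0 := by
    have h := hT' 2
    have h0 := hY 0
    have h1 := hY 1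
    have h2 := hY 2
    have e2 := E 0
    have e3 := E 1
    simp only [hc1, hK0, E1, map_zero, map_one, map_sub, map_add, map_mul, map_pow,
      map_neg, map_ofNat, zero_add, Nat.reduceAdd, Nat.reduceSub] at h h0 h1 h2 e2 e3 ⊢
    linear_combination h - e3 + (C α * Y - C (b 2)) * e2
      + C α * (C (c 3) - C α * C (c 2)) * h2
      + C α * (C (c 2) * (C (b 2) - C α * C (b 1))) * h1
      + C α * (C (K 2) - C α * C (c 2) * C (K 1)) * h0
      + (C α ^ 2 - 1) * C (c 2) * (Y * h1 + h2 + C (b 1) * h1 + C (K 1) * h0)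
  have R (m : ℕ) :
      C (c (m + 5) - α * c (m + 4) - α * (c (m + 4) - α * c (m + 3))
        - (α ^ 2 - 1) * c (m + 3)) * P (m + 4)
      + C (c (m + 4) * (b (m + 4) - α * b (m + 3)) - α * (c (m + 4) - α * c (m + 3)) * b (m + 3)
        - α * (c (m + 3) * (b (m + 3) - α * b (m + 2)))
        + b (m + 3) * (c (m + 4) - α * c (m + 3))
        - (α ^ 2 - 1) * c (m + 3) * (b (m + 3) + b (m + 2))) * P (m + 3)
      + C (c (m + 3) * K (m + 4) - α * c (m + 4) * K (m + 3)
        - α * (c (m + 4) - α * c (m + 3)) * K (m + 3)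
        - c (m + 3) * (b (m + 3) - α * b (m + 2)) * (α * b (m + 2) - b (m + 3))
        - α * (c (m + 2) * K (m + 3) - α * c (m + 3) * K (m + 2))
        - (α ^ 2 - 1) * c (m + 3) * (K (m + 3) + b (m + 2) ^ 2 + K (m + 2) - 4 * d)
        + K (m + 3) * (c (m + 3) - α * c (m + 2))) * P (m + 2)
      + C (-(α * (c (m + 3) * (b (m + 3) - α * b (m + 2))) * K (m + 2)
        + (c (m + 2) * K (m + 3) - α * c (m + 3) * K (m + 2)) * (α * b (m + 1) - b (m + 3))
        + (α ^ 2 - 1) * c (m + 3) * K (m + 2) * (b (m + 2) + b (m + 1))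
        - K (m + 3) * (c (m + 2) * (b (m + 2) - α * b (m + 1))))) * P (m + 1)
      + C (-(α * (c (m + 2) * K (m + 3) - α * c (m + 3) * K (m + 2)) * K (m + 1)
        + (α ^ 2 - 1) * c (m + 3) * K (m + 2) * K (m + 1)
        - K (m + 3) * (c (m + 1) * K (m + 2) - α * c (m + 2) * K (m + 1)))) * P m = 0 := by
    have h := hT' (m + 3)
    have h1 := hY (m + 1)
    have h2 := hY (m + 2)
    have h3 := hY (m + 3)
    have e2 := E m
    have e3 := E (m + 1)
    have e4 := E (m + 2)
    simp only [map_one, map_sub, map_add, map_mul, map_pow, map_neg, map_ofNat, add_assoc,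
      Nat.reduceAdd, Nat.add_sub_cancel, show m + 3 - 1 = m + 2 from rfl,
      show m + 2 - 1 = m + 1 from rfl] at h h1 h2 h3 e2 e3 e4 ⊢
    linear_combination h - e4 + (C α * Y - C (b (m + 3))) * e3 - C (K (m + 3)) * e2
      + C α * (C (c (m + 4)) - C α * C (c (m + 3))) * h3
      + C α * (C (c (m + 3)) * (C (b (m + 3)) - C α * C (b (m + 2)))) * h2
      + C α * (C (c (m + 2)) * C (K (m + 3)) - C α * C (c (m + 3)) * C (K (m + 2))) * h1
      + (C α ^ 2 - 1) * C (c (m + 3))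
        * (Y * h2 + h3 + C (b (m + 2)) * h2 + C (K (m + 2)) * h1)
  obtain ⟨-, -, -, r01, r00⟩ := coeffs_eq_zero_of_consecutive hPm hPd 0 _ _ _ _ _ R0
  obtain ⟨-, -, r12, r11, r10⟩ := coeffs_eq_zero_of_consecutive hPm hPd 0 _ _ _ _ _ R1
  obtain ⟨-, r23, r22, r21, r20⟩ := coeffs_eq_zero_of_consecutive hPm hPd 0 _ _ _ _ _ R2
  have r (m : ℕ) := coeffs_eq_zero_of_consecutive hPm hPd m _ _ _ _ _ (R m)
  refine ⟨?_, ?_, ?_, ?_, ?_, ?_⟩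
  · rintro (_ | _ | _ | m)
    · simp only [zero_add, hc0]; linear_combination r01
    · simp only [zero_add, Nat.reduceAdd]; linear_combination r12
    · simp only [zero_add, Nat.reduceAdd]; linear_combination r23
    · simp only [add_assoc, Nat.reduceAdd]; linear_combination (r m).1
  · rw [hc1] at r00
    linear_combination r00
  · rintro (_ | _ | m)
    · simp only [zero_add]; linear_combination r11
    · simp only [zero_add, Nat.reduceAdd]; linear_combination r22
    · simp only [add_assoc, Nat.reduceAdd]; linear_combination (r m).2.1
  · rintro (_ | _ | m)
    · simp only [zero_add, hc0, hK0]
      rw [hc1] at r10 ⊢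
      linear_combination r10
    · simp only [zero_add, Nat.reduceAdd]; linear_combination r21
    · simp only [add_assoc, Nat.reduceAdd]; linear_combination (r m).2.2.1
  · linear_combination -r20
  · have h := (r 0).2.2.2.2
    simp only [zero_add] at h
    linear_combination -h

lemma eq_one_sub_pow_mul_of_recurrence {K : ℕ → ℂ} {x y d : ℂ} (hxy : x * y = 1) (h0 : K 0 = 0)
    (h1 : K 1 = (1 - x) * d)
    (h : ∀ n, K (n + 2) = (x + y) * K (n + 1) - K n - (x + y - 2) * d) (n : ℕ) :
    K n = (1 - x ^ n) * d := by
  suffices K n = (1 - x ^ n) * d ∧ K (n + 1) = (1 - x ^ (n + 1)) * d from this.1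
  induction n with
  | zero => simp [h0, h1]
  | succ n ih =>
    refine ⟨ih.2, ?_⟩
    rw [h n, ih.1, ih.2]
    linear_combination -x ^ n * d * hxy

/-- The initial values forced by the first coefficient relations. -/
lemma initial_values_of_relations {p pi b₀ d K₁ K₂ K₃ : ℂ} (hp : p * pi = 1) (hp1 : p ≠ 1)
    (hpn : p + 1 ≠ 0) (hp2 : p ^ 2 + 1 ≠ 0) (hp3 : p ^ 4 + p ^ 2 + 1 ≠ 0) (hK₁ : K₁ ≠ 0)
    (h2 : K₂ = (p ^ 2 + pi ^ 2) * K₁ + (p + pi - 2) * b₀ ^ 2 - (p ^ 2 + pi ^ 2 - 2) * d)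
    (h3 : K₃ = (p ^ 2 + pi ^ 2) * K₂ - K₁ + (p + pi - 2) * b₀ ^ 2 - (p ^ 2 + pi ^ 2 - 2) * d)
    (hq : (p + pi) ^ 2 * K₃ * K₁ - ((p + pi) ^ 2 - 1) * K₂ * K₁ - K₃ * K₂ = 0)
    (hb : b₀ * ((p + pi) ^ 2 / 2 * (p + pi + 1) * K₁
      - (K₂ - (p + pi) ^ 2 / 2 * K₁) * (2 * (p + pi) + 1)
      + (p + pi + 2) * (p + pi) ^ 2 / 2 * K₁ - K₂) = 0) :
    b₀ = 0 ∧ (K₁ = (1 - p ^ 2) * d ∨ K₁ = (1 - pi ^ 2) * d) := by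
  have hp0 : p ≠ 0 := left_ne_zero_of_mul_eq_one hp
  obtain rfl : pi = p⁻¹ := eq_inv_of_mul_eq_one_right hp
  have hpm : p - 1 ≠ 0 := sub_ne_zero.mpr hp1
  obtain ⟨g, hg⟩ : ∃ g, g = d - b₀ ^ 2 * p / (p + 1) ^ 2 := ⟨_, rfl⟩
  have hκ : (p + p⁻¹ - 2) * b₀ ^ 2 - (p ^ 2 + p⁻¹ ^ 2 - 2) * d
      = -(p ^ 2 + p⁻¹ ^ 2 - 2) * g := by
    rw [hg]; field_simp; ring
  obtain ⟨k, hk⟩ : ∃ k, K₁ = (1 - p⁻¹ ^ 2) * (g + k * (p ^ 2 + 1)) := by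
    refine ⟨(K₁ * p ^ 2 / ((p - 1) * (p + 1)) - g) / (p ^ 2 + 1), ?_⟩
    field_simp
    ring
  have hk2 : K₂ = (1 - p⁻¹ ^ 4) * (g + k * (p ^ 4 + 1)) := by
    rw [h2, add_sub_assoc, hκ, hk]; field_simp; ring
  have hk3 : K₃ = (1 - p⁻¹ ^ 6) * (g + k * (p ^ 6 + 1)) := by
    rw [h3, add_sub_assoc, hκ, hk2, hk]; field_simp; ring
  have hgk : k * (g + k) = 0 := by
    have : k * (g + k)
        * (((p - 1) * (p + 1)) ^ 4 * (p ^ 2 + 1) ^ 2 * (p ^ 4 + p ^ 2 + 1)) = 0 := by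
      rw [hk, hk2, hk3] at hq
      rw [← mul_zero (p ^ 8), ← hq]
      field_simp
      ring
    exact (mul_eq_zero.mp this).resolve_right (by simp_all [sub_ne_zero])
  have hp3' : p ^ 2 + p + 1 ≠ 0 := fun h => hp3 (by linear_combination (p ^ 2 - p + 1) * h)
  have hb0 : b₀ = 0 := by
    have : b₀ * K₁ * ((p ^ 2 + p + 1) * (p ^ 2 + 1)) = 0 := by
      rcases mul_eq_zero.mp hgk with h | h
      · rw [h] at hk hk2
        have e : K₂ = (1 + p⁻¹ ^ 2) * K₁ := by rw [hk2, hk]; ring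
        rw [e] at hb
        rw [← mul_zero (p / 2), ← hb]
        field_simp
        ring
      · rw [eq_neg_of_add_eq_zero_left h] at hk hk2
        have e : K₂ = (1 + p ^ 2) * K₁ := by rw [hk2, hk]; field_simp; ring
        rw [e] at hb
        rw [← mul_zero (p ^ 3 / 2), ← hb]
        field_simp
        ring
    simpa [hK₁, hp3', hp2] using this
  have hgd : g = d := by simp [hg, hb0]
  refine ⟨hb0, ?_⟩
  rcases mul_eq_zero.mp hgk with h | h
  · right
    rw [hk, h, hgd]; ring
  · left
    rw [hk, eq_neg_of_add_eq_zero_right h, hgd]; field_simp; ring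

lemma solve_appell_coefficient_relations {p pi α d : ℂ} {b K c : ℕ → ℂ} (hp : p * pi = 1)
    (hα : α = (p + pi) / 2) (hp1 : p ≠ 1)
    (hpn : p + 1 ≠ 0) (hp2 : p ^ 2 + 1 ≠ 0) (hp3 : p ^ 4 + p ^ 2 + 1 ≠ 0)
    (hc0 : c 0 = 0) (hc1 : c 1 = 1) (hK0 : K 0 = 0)
    (hc : ∀ n, c (n + 1) ≠ 0) (hK : K 1 ≠ 0)
    (r0 : ∀ n, c (n + 2) = 2 * α * c (n + 1) - c n)
    (r1 : b 1 = (2 * α - 1) * b 0)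
    (r2 : ∀ n, c (n + 2) * (b (n + 2) - α * b (n + 1))
      = (α - 1) * (c (n + 2) - α * c (n + 1)) * b (n + 1)
        + α * c (n + 1) * (b (n + 1) - α * b n)
        + (α ^ 2 - 1) * c (n + 1) * (b (n + 1) + b n))
    (r3 : ∀ n, c (n + 1) * K (n + 2) - α * c (n + 2) * K (n + 1)
      = α * (c (n + 2) - α * c (n + 1)) * K (n + 1)
        - c (n + 1) * (b (n + 1) - α * b n) ^ 2
        + α * (c n * K (n + 1) - α * c (n + 1) * K n)
        + (α ^ 2 - 1) * c (n + 1) * (K (n + 1) + b n ^ 2 + K n - 4 * d)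
        - K (n + 1) * (c (n + 1) - α * c n))
    (r4 : α * (c 2 * (b 2 - α * b 1)) * K 1 + (c 1 * K 2 - α * c 2 * K 1) * (α * b 0 - b 2)
      + (α ^ 2 - 1) * c 2 * K 1 * (b 1 + b 0) - K 2 * (c 1 * (b 1 - α * b 0)) = 0)
    (r5 : α * (c 2 * K 3 - α * c 3 * K 2) * K 1 + (α ^ 2 - 1) * c 3 * K 2 * K 1
      - K 3 * (c 1 * K 2 - α * c 2 * K 1) = 0) :
    (∀ n, c n * (p - pi) = p ^ n - pi ^ n) ∧ (∀ n, b n = 0) ∧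
    ((∀ n, K n = (1 - (p ^ 2) ^ n) * d) ∨ (∀ n, K n = (1 - (pi ^ 2) ^ n) * d)) := by
  have hA : 2 * α = p + pi := by rw [hα]; ring
  have hc2 : c 2 = 2 * α := by rw [r0 0, zero_add, hc1, hc0]; ring
  have hc3 : c 3 = 4 * α ^ 2 - 1 := by rw [r0 1, hc2, hc1]; ring
  have hα0 : 2 * α ≠ 0 := hc2 ▸ hc 1
  have hb2 : b 2 = (4 * α ^ 2 - 2 * α - 1) * b 0 := by
    have h := r2 0
    simp only [zero_add, hc1, hc2, r1] at h
    apply mul_left_cancel₀ hα0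
    linear_combination h
  have rK (n : ℕ) : K (n + 2) = (4 * α ^ 2 - 2) * K (n + 1) - K n
      - (b (n + 1) ^ 2 - 2 * α * b (n + 1) * b n + b n ^ 2) - 4 * (α ^ 2 - 1) * d := by
    apply mul_left_cancel₀ (hc n)
    linear_combination r3 n + 2 * α * K (n + 1) * r0 n
  have hA2 : 4 * α ^ 2 = p ^ 2 + pi ^ 2 + 2 := by
    linear_combination (2 * α + p + pi) * hA + 2 * hp
  obtain ⟨hb0, hK1⟩ : b 0 = 0 ∧ (K 1 = (1 - p ^ 2) * d ∨ K 1 = (1 - pi ^ 2) * d) := by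
    refine initial_values_of_relations (K₂ := K 2) (K₃ := K 3) hp hp1 hpn hp2 hp3 hK ?_ ?_ ?_ ?_
    · have h := rK 0
      simp only [zero_add, hK0, r1] at h
      linear_combination h + (K 1 - d) * hA2 + b 0 ^ 2 * hA
    · have h := rK 1
      simp only [Nat.reduceAdd, hb2, r1] at h
      linear_combination h + (K 2 - d) * hA2 + b 0 ^ 2 * hA
    · rw [hc1, hc2, hc3] at r5
      rw [← hA]
      linear_combination r5
    · have hα1 : α - 1 ≠ 0 := by
        intro h
        have : (p - 1) ^ 2 = 0 := by linear_combination p * (2 * h - hA) - hp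
        exact hp1 (sub_eq_zero.mp (pow_eq_zero_iff two_ne_zero |>.mp this))
      rw [← hA]
      apply mul_left_cancel₀ hα1
      rw [hc1, hc2, hb2, r1] at r4
      linear_combination r4
  have hb (n : ℕ) : b n = 0 := by
    suffices b n = 0 ∧ b (n + 1) = 0 from this.1
    induction n with
    | zero => simp [hb0, r1]
    | succ n ih =>
      refine ⟨ih.2, ?_⟩
      have h := r2 n
      rw [ih.1, ih.2] at h
      simpa [hc (n + 1)] using h
  refine ⟨fun n => ?_, hb, ?_⟩
  · suffices c n * (p - pi) = p ^ n - pi ^ n ∧ c (n + 1) * (p - pi) = p ^ (n + 1) - pi ^ (n + 1)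
      from this.1
    induction n with
    | zero => simp [hc0, hc1]
    | succ n ih =>
      refine ⟨ih.2, ?_⟩
      rw [r0 n]
      linear_combination (p + pi) * ih.2 - ih.1 + (p - pi) * c (n + 1) * hA
        + (p ^ n - pi ^ n) * hp
  · have rK' (n : ℕ) : K (n + 2) = (p ^ 2 + pi ^ 2) * K (n + 1) - K n
        - (p ^ 2 + pi ^ 2 - 2) * d := by
      rw [rK n, hb, hb]
      linear_combination (K (n + 1) - d) * hA2
    have hpp : p ^ 2 * pi ^ 2 = 1 := by rw [← mul_pow, hp, one_pow]
    refine hK1.imp (fun h => ?_) (fun h => ?_)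
    · exact eq_one_sub_pow_mul_of_recurrence hpp hK0 h rK'
    · refine eq_one_sub_pow_mul_of_recurrence (mul_comm (p ^ 2) _ ▸ hpp) hK0 h fun n => ?_
      rw [rK' n]
      ring

/-- The coefficients of a monic sequence satisfying a three-term recurrence and the Appell
property `D (P n) = cs n • P (n - 1)`. -/
lemma appell_recurrence_coefficients {D S : ℂ[X] → ℂ[X]} {p pi α e d : ℂ}
    (H : ∀ w, (w - e) ^ 2 ≠ 4 * d → ∃ a b, LatticePair D S α e d w a b)
    (hp : p * pi = 1) (hα : α = (p + pi) / 2) (hp1 : p ≠ 1)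
    (hpn : p + 1 ≠ 0) (hp2 : p ^ 2 + 1 ≠ 0) (hp3 : p ^ 4 + p ^ 2 + 1 ≠ 0)
    {P : ℕ → ℂ[X]} (hPm : ∀ n, (P n).Monic) (hPd : ∀ n, (P n).natDegree = n)
    {B Cc cs : ℕ → ℂ} (hT1 : P 1 = (X - C (B 0)) * P 0)
    (hT : ∀ n, 1 ≤ n → P (n + 1) = (X - C (B n)) * P n - C (Cc n) * P (n - 1))
    (hCne : ∀ n, 1 ≤ n → Cc n ≠ 0) (hcne : ∀ n : ℕ, 1 ≤ n → cs n ≠ 0)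
    (hcs : ∀ n : ℕ, 1 ≤ n → D (P n) = C (cs n) * P (n - 1)) :
    (∀ n, 1 ≤ n → cs n * (p - pi) = p ^ n - pi ^ n) ∧ (∀ n, B n = e) ∧
    ((∀ n, Cc (n + 1) = (1 - (p ^ 2) ^ (n + 1)) * d) ∨
      (∀ n, Cc (n + 1) = (1 - (pi ^ 2) ^ (n + 1)) * d)) := by
  obtain ⟨b, hbdef⟩ : ∃ b : ℕ → ℂ, ∀ n, b n = B n - e := ⟨_, fun _ => rfl⟩
  obtain ⟨c, hcdef⟩ : ∃ c : ℕ → ℂ, ∀ n, c n = if n = 0 then 0 else cs n := ⟨_, fun _ => rfl⟩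
  obtain ⟨K, hKdef⟩ : ∃ K : ℕ → ℂ, ∀ n, K n = if n = 0 then 0 else Cc n := ⟨_, fun _ => rfl⟩
  have hc0 : c 0 = 0 := by simp [hcdef]
  have hK0 : K 0 = 0 := by simp [hKdef]
  have hP0 : P 0 = C 1 := by
    rw [C_1]; exact (hPm 0).natDegree_eq_zero.mp (hPd 0)
  have hP (n : ℕ) :
      P (n + 1) = ((X - C e) - C (b n)) * P n - C (K n) * P (n - 1) := by
    rcases n with _ | n
    · rw [zero_add, hT1, hK0, hbdef, C_0, C_sub]
      ring
    · rw [hT (n + 1) (Nat.le_add_left 1 n), hKdef, if_neg n.succ_ne_zero, hbdef, C_sub]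
      ring
  have hD (n : ℕ) : D (P n) = C (c n) * P (n - 1) := by
    rcases n with _ | n
    · rw [hP0, divDiff_const H, hc0, C_0, zero_mul]
    · rw [hcs (n + 1) (Nat.le_add_left 1 n), hcdef, if_neg n.succ_ne_zero]
  have hS (n : ℕ) : C (c (n + 1)) * P n = S (P n)
      + (C (α) * (X - C e) - C (b n)) * (C (c n) * P (n - 1))
      - C (K n) * (C (c (n - 1)) * P (n - 1 - 1)) := by
    have h := divDiff_recurrence H (P n) (P (n - 1)) (b n) (K n)
    rwa [← hP n, hD, hD, hD] at h
  have hS' (n : ℕ) : S (P (n + 1)) = (C (α) * (X - C e) - C (b n)) * S (P n)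
      + C (α ^ 2 - 1) * ((X - C e) ^ 2 - C (4 * d)) * (C (c n) * P (n - 1))
      - C (K n) * S (P (n - 1)) := by
    have h := avg_recurrence H (P n) (P (n - 1)) (b n) (K n)
    rwa [← hP n, hD] at h
  have hc1 : c 1 = 1 := by
    have h := hS 0
    rw [hP0, avg_const H, hc0, hK0] at h
    exact C_injective (by simpa using h)
  obtain ⟨r0, r1, r2, r3, r4, r5⟩ := appell_coefficient_relations (T := fun n => S (P n))
    hPm hPd hc0 hc1 hK0 hP hS hS'
  obtain ⟨hcn, hbn, hKn⟩ := solve_appell_coefficient_relations hp hα hp1 hpn hp2 hp3 hc0 hc1 hK0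
    (fun n => by simpa [hcdef] using hcne (n + 1) (Nat.le_add_left 1 n))
    (by simpa [hKdef] using hCne 1 le_rfl) r0 r1 r2 r3 r4 r5
  refine ⟨fun n hn => ?_, fun n => sub_eq_zero.mp (hbdef n ▸ hbn n),
    hKn.imp (fun h n => ?_) (fun h n => ?_)⟩
  · rw [← hcn n, hcdef, if_neg (Nat.one_le_iff_ne_zero.mp hn)]
  all_goals rw [← h (n + 1), hKdef, if_neg n.succ_ne_zero]

lemma qp_add (q : ℝ) (s t : ℂ) : qp q (s + t) = qp q s * qp q t := by
  rw [qp, qp, qp, add_mul, Complex.exp_add]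

lemma qp_mul_qp_neg (q : ℝ) (t : ℂ) : qp q t * qp q (-t) = 1 := by
  rw [← qp_add, add_neg_cancel, qp, zero_mul, Complex.exp_zero]

lemma qp_nat_mul (q : ℝ) (n : ℕ) (t : ℂ) : qp q (n * t) = qp q t ^ n := by
  rw [qp, qp, mul_assoc, Complex.exp_nat_mul]

lemma qp_half_eq_ofReal (q : ℝ) : qp q (1 / 2) = ((Real.exp (Real.log q / 2) : ℝ) : ℂ) := by
  rw [qp, Complex.ofReal_exp]
  congr 1
  push_cast
  ring

lemma exists_qp_eq {q : ℝ} (hl : Real.log q ≠ 0) {z : ℂ} (hz : z ≠ 0) : ∃ s, qp q s = z := by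
  have hl' : (Real.log q : ℂ) ≠ 0 := by exact_mod_cast hl
  exact ⟨Complex.log z / Real.log q, by rw [qp, div_mul_cancel₀ _ hl', Complex.exp_log hz]⟩

lemma exists_latX_eq {q : ℝ} (hl : Real.log q ≠ 0) {c1 c2 : ℂ} (hc : c1 * c2 ≠ 0) (c3 w : ℂ) :
    ∃ s, latX q c1 c2 c3 s = w := by
  have hc2 : c2 ≠ 0 := right_ne_zero_of_mul hc
  obtain ⟨r, hr⟩ := IsAlgClosed.exists_pow_nat_eq ((c3 - w) ^ 2 - 4 * (c1 * c2)) two_pos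
  obtain ⟨z, hz⟩ : ∃ z, c2 * z ^ 2 + (c3 - w) * z + c1 = 0 := by
    refine ⟨(w - c3 + r) / (2 * c2), ?_⟩
    field_simp
    linear_combination hr
  have hz0 : z ≠ 0 := by
    rintro rfl
    exact left_ne_zero_of_mul hc (by linear_combination hz)
  obtain ⟨s, rfl⟩ := exists_qp_eq hl hz0
  refine ⟨s, ?_⟩
  apply mul_right_cancel₀ hz0
  rw [latX]
  linear_combination hz + c1 * qp_mul_qp_neg q s

lemma exists_latticePair {q : ℝ} (hl : Real.log q ≠ 0) {c1 c2 c3 : ℂ} (hc : c1 * c2 ≠ 0)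
    {Dx Sx : ℂ[X] → ℂ[X]}
    (hDx : ∀ (f : ℂ[X]) (s : ℂ),
      latX q c1 c2 c3 (s + 1/2) ≠ latX q c1 c2 c3 (s - 1/2) →
      (Dx f).eval (latX q c1 c2 c3 s) =
        (f.eval (latX q c1 c2 c3 (s + 1/2)) - f.eval (latX q c1 c2 c3 (s - 1/2))) /
          (latX q c1 c2 c3 (s + 1/2) - latX q c1 c2 c3 (s - 1/2)))
    (hSx : ∀ (f : ℂ[X]) (s : ℂ),
      (Sx f).eval (latX q c1 c2 c3 s) =
        (f.eval (latX q c1 c2 c3 (s + 1/2)) + f.eval (latX q c1 c2 c3 (s - 1/2))) / 2)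
    (hα : alphaL q ^ 2 ≠ 1) (w : ℂ) (hw : (w - c3) ^ 2 ≠ 4 * (c1 * c2)) :
    ∃ a b, LatticePair Dx Sx (alphaL q) c3 (c1 * c2) w a b := by
  obtain ⟨s, rfl⟩ := exists_latX_eq hl hc c3 w
  have hp := qp_mul_qp_neg q (1 / 2)
  have hz := qp_mul_qp_neg q s
  have ha : latX q c1 c2 c3 (s + 1 / 2)
      = c1 * (qp q (-s) * qp q (-(1 / 2))) + c2 * (qp q s * qp q (1 / 2)) + c3 := by
    rw [latX, neg_add, qp_add, qp_add]
  have hb : latX q c1 c2 c3 (s - 1 / 2)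
      = c1 * (qp q (-s) * qp q (1 / 2)) + c2 * (qp q s * qp q (-(1 / 2))) + c3 := by
    rw [latX, neg_sub', sub_neg_eq_add, qp_add, sub_eq_add_neg, qp_add]
  have hsq : (latX q c1 c2 c3 (s + 1 / 2) - latX q c1 c2 c3 (s - 1 / 2)) ^ 2
      = 4 * (alphaL q ^ 2 - 1) * ((latX q c1 c2 c3 s - c3) ^ 2 - 4 * (c1 * c2)) := by
    rw [ha, hb, latX, alphaL]
    have h1 : 4 * (((qp q (1 / 2) + qp q (-(1 / 2))) / 2) ^ 2 - 1)
        = (qp q (1 / 2) - qp q (-(1 / 2))) ^ 2 := by linear_combination 4 * hp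
    rw [h1]
    linear_combination -4 * c1 * c2 * (qp q (1 / 2) - qp q (-(1 / 2))) ^ 2 * hz
  have hne : latX q c1 c2 c3 (s + 1 / 2) ≠ latX q c1 c2 c3 (s - 1 / 2) := by
    intro h
    rw [h, sub_self, zero_pow two_ne_zero, eq_comm] at hsq
    simp [sub_eq_zero, hα, hw] at hsq
  refine ⟨_, _, hne, ?_, hsq, fun f => ?_, fun f => ?_⟩
  · rw [ha, hb, latX, alphaL]
    ring
  · rw [hDx f s hne, div_mul_cancel₀ _ (sub_ne_zero.mpr hne)]
  · rw [hSx f s, div_mul_cancel₀ _ two_ne_zero]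

theorem stmt_19 (q : ℝ) (hq : 0 < q) (hq1 : q ≠ 1) (c1 c2 c3 : ℂ) (hc : c1 * c2 ≠ 0)
    (Dx Sx : Polynomial ℂ → Polynomial ℂ)
    (hDx : ∀ (f : Polynomial ℂ) (s : ℂ),
      latX q c1 c2 c3 (s + 1/2) ≠ latX q c1 c2 c3 (s - 1/2) →
      (Dx f).eval (latX q c1 c2 c3 s) =
        (f.eval (latX q c1 c2 c3 (s + 1/2)) - f.eval (latX q c1 c2 c3 (s - 1/2))) /
          (latX q c1 c2 c3 (s + 1/2) - latX q c1 c2 c3 (s - 1/2)))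
    (hSx : ∀ (f : Polynomial ℂ) (s : ℂ),
      (Sx f).eval (latX q c1 c2 c3 s) =
        (f.eval (latX q c1 c2 c3 (s + 1/2)) + f.eval (latX q c1 c2 c3 (s - 1/2))) / 2)
    (u : Polynomial ℂ →ₗ[ℂ] ℂ)
    (P : ℕ → Polynomial ℂ)
    (hPm : ∀ n, (P n).Monic) (hPd : ∀ n, (P n).natDegree = n)
    (hPo : ∀ n m, n ≠ m → u (P n * P m) = 0)
    (hPn : ∀ n, u (P n * P n) ≠ 0)
    (B Cc : ℕ → ℂ)
    (hT1 : P 1 = (X - C (B 0)) * P 0)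
    (hT : ∀ n, 1 ≤ n → P (n + 1) = (X - C (B n)) * P n - C (Cc n) * P (n - 1))
    (hCne : ∀ n, 1 ≤ n → Cc n ≠ 0)
    (cs : ℕ → ℂ)
    (hcne : ∀ n : ℕ, 1 ≤ n → cs n ≠ 0)
    (hcs : ∀ n : ℕ, 1 ≤ n → Dx (P n) = C (cs n) * P (n - 1)) :
    (∀ n : ℕ, 1 ≤ n → cs n = gammaN q n) ∧
    (∀ n : ℕ, B n = c3) ∧
    ((∀ n : ℕ, Cc (n + 1) = (1 - qp q ((n : ℂ) + 1)) * (c1 * c2)) ∨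
     (∀ n : ℕ, Cc (n + 1) = (1 - qp q (-((n : ℂ) + 1))) * (c1 * c2))) := by
  have hl : Real.log q ≠ 0 := Real.log_ne_zero_of_pos_of_ne_one hq hq1
  have hp := qp_mul_qp_neg q (1 / 2)
  have hpr := qp_half_eq_ofReal q
  have hr0 := Real.exp_pos (Real.log q / 2)
  have hr1 : Real.exp (Real.log q / 2) ≠ 1 := by
    simpa [Real.exp_eq_one_iff] using hl
  have hα : alphaL q = (qp q (1 / 2) + qp q (-(1 / 2))) / 2 := rfl
  generalize Real.exp (Real.log q / 2) = r at hpr hr0 hr1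
  have hp1 : qp q (1 / 2) ≠ 1 := by rw [hpr]; exact_mod_cast hr1
  have hpn : qp q (1 / 2) + 1 ≠ 0 := by
    rw [hpr]; exact_mod_cast (by positivity : r + 1 ≠ 0)
  have hp2 : qp q (1 / 2) ^ 2 + 1 ≠ 0 := by
    rw [hpr]; exact_mod_cast (by positivity : r ^ 2 + 1 ≠ 0)
  have hp3 : qp q (1 / 2) ^ 4 + qp q (1 / 2) ^ 2 + 1 ≠ 0 := by
    rw [hpr]; exact_mod_cast (by positivity : r ^ 4 + r ^ 2 + 1 ≠ 0)
  have hpsub : qp q (1 / 2) - qp q (-(1 / 2)) ≠ 0 := by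
    intro h
    have : (qp q (1 / 2) - 1) * (qp q (1 / 2) + 1) = 0 := by
      linear_combination qp q (1 / 2) * h + hp
    exact (mul_eq_zero.mp this).elim (fun h => hp1 (sub_eq_zero.mp h)) hpn
  have hα1 : alphaL q ^ 2 ≠ 1 := by
    intro h
    rw [hα] at h
    exact pow_ne_zero 2 hpsub (by linear_combination 4 * h - 4 * hp)
  have H := exists_latticePair hl hc hDx hSx hα1
  obtain ⟨hcn, hBn, hKn⟩ := appell_recurrence_coefficients H hp hα hp1 hpn hp2 hp3 hPm hPd
    hT1 hT hCne hcne hcs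
  have hpow (t : ℂ) (n : ℕ) : (qp q t ^ 2) ^ (n + 1) = qp q (((n : ℂ) + 1) * (2 * t)) := by
    rw [← pow_mul, ← qp_nat_mul]
    push_cast
    ring_nf
  refine ⟨fun n hn => ?_, hBn, ?_⟩
  · have h := hcn n hn
    rw [← qp_nat_mul, ← qp_nat_mul] at h
    rw [gammaN, eq_div_iff hpsub, h]
    ring_nf
  · refine hKn.imp (fun h n => ?_) (fun h n => ?_)
    all_goals
      rw [h n, hpow]
      ring_nf
end
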